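/- Fix γ, k ∈ (0,1) and a compact set B ⊂ ℝ^d. For z = (x,y) ∈ ℝ^d × {0,1} let l(β;z) = log[q·(1−γ)^y γ^{1−y} + (1−q)·(1−γ^k)^y γ^{k(1−y)}] with q = (1+e^{−xᵀβ})^{−1}, and P_m l(β) = m^{−1}Σ_{i=1}^m l(β;z_i). If the z_i are independent and sup_{1≤i≤m} E‖x_i‖² < ∞, then E[ sup_{β∈B} |P_m l(β) − E[P_m l(β)]| ] = O(m^{−1/2}). -/

import Mathlib

open MeasureTheory ProbabilityTheory Filter
open scoped BigOperators

noncomputable section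

/-- Inner product `xᵀβ`. -/
def dotp {d : ℕ} (x β : EuclideanSpace ℝ (Fin d)) : ℝ := ∑ i, x i * β i

/-- The quasi log-likelihood term `l(β;(x,y))`. -/
def lfun {d : ℕ} (γ k : ℝ) (x : EuclideanSpace ℝ (Fin d)) (y : ℝ)
    (β : EuclideanSpace ℝ (Fin d)) : ℝ :=
  Real.log ((1 + Real.exp (-dotp x β))⁻¹ * ((1 - γ) ^ y * γ ^ (1 - y))
    + (1 - (1 + Real.exp (-dotp x β))⁻¹) * ((1 - γ ^ k) ^ y * γ ^ (k * (1 - y))))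

lemma g_lip (c e s t : ℝ) (hc : 0 < c) (he : 0 < e) (hst : s ≤ t) :
    Real.log (c + e * Real.exp (-t)) ≤ Real.log (c + e * Real.exp (-s)) ∧
    Real.log (c + e * Real.exp (-s)) ≤ Real.log (c + e * Real.exp (-t)) + (t - s) := by
  constructor
  · apply Real.log_le_log (by positivity)
    gcongr
  · rw [← Real.log_exp (t - s), ← Real.log_mul (by positivity) (by positivity)]
    apply Real.log_le_log (by positivity)
    have h1 : Real.exp (-s) = Real.exp (-t) * Real.exp (t - s) := by
      rw [← Real.exp_add]; ring_nf
    have h2 : 1 ≤ Real.exp (t - s) := Real.one_le_exp (by linarith)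
    rw [h1, add_mul]
    nlinarith

lemma mix_eq (a b t : ℝ) (ha : 0 < a) (hb : 0 < b) :
    Real.log ((1 + Real.exp (-t))⁻¹ * a + (1 - (1 + Real.exp (-t))⁻¹) * b)
      = Real.log (a + b * Real.exp (-t)) - Real.log (1 + 1 * Real.exp (-t)) := by
  rw [← Real.log_div (by positivity) (by positivity)]
  congr 1
  have : 0 < 1 + Real.exp (-t) := by positivity
  field_simp
  ring

lemma mix_lip (a b s t : ℝ) (ha : 0 < a) (hb : 0 < b) :
    |Real.log ((1 + Real.exp (-s))⁻¹ * a + (1 - (1 + Real.exp (-s))⁻¹) * b)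
      - Real.log ((1 + Real.exp (-t))⁻¹ * a + (1 - (1 + Real.exp (-t))⁻¹) * b)| ≤ |s - t| := by
  rw [mix_eq a b s ha hb, mix_eq a b t ha hb]
  rcases le_total s t with h | h
  · have h1 := g_lip a b s t ha hb h
    have h2 := g_lip 1 1 s t one_pos one_pos h
    rw [abs_sub_comm s t, abs_of_nonneg (sub_nonneg.2 h), abs_le]
    constructor <;> linarith [h1.1, h1.2, h2.1, h2.2]
  · have h1 := g_lip a b t s ha hb h
    have h2 := g_lip 1 1 t s one_pos one_pos h
    rw [abs_of_nonneg (sub_nonneg.2 h), abs_le]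
    constructor <;> linarith [h1.1, h1.2, h2.1, h2.2]

lemma mix_bdd (a b t δ : ℝ) (hδ : 0 < δ) (ha : δ ≤ a) (hb : δ ≤ b) (ha1 : a ≤ 1) (hb1 : b ≤ 1) :
    |Real.log ((1 + Real.exp (-t))⁻¹ * a + (1 - (1 + Real.exp (-t))⁻¹) * b)| ≤ - Real.log δ := by
  have h0 : 0 < (1 + Real.exp (-t))⁻¹ := by positivity
  have h1 : (1 + Real.exp (-t))⁻¹ ≤ 1 := inv_le_one_of_one_le₀ (by linarith [Real.exp_pos (-t)])
  set q := (1 + Real.exp (-t))⁻¹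
  have h2 : δ ≤ q * a + (1 - q) * b := by nlinarith
  have h3 : q * a + (1 - q) * b ≤ 1 := by nlinarith
  rw [abs_of_nonpos (Real.log_nonpos (by linarith) h3)]
  exact neg_le_neg (Real.log_le_log hδ h2)

lemma lfun_facts {d : ℕ} (γ k : ℝ) (hγ : γ ∈ Set.Ioo (0:ℝ) 1) (hk : k ∈ Set.Ioo (0:ℝ) 1) :
    ∃ M : ℝ, 0 ≤ M ∧ ∀ (x : EuclideanSpace ℝ (Fin d)) (y : ℝ), (y = 0 ∨ y = 1) →
      (∀ β, |lfun γ k x y β| ≤ M) ∧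
      ∀ β β', |lfun γ k x y β - lfun γ k x y β'| ≤ |inner ℝ x β - inner ℝ x β'| := by
  obtain ⟨hγ0, hγ1⟩ := hγ
  obtain ⟨hk0, hk1⟩ := hk
  have hg0 : 0 < γ ^ k := Real.rpow_pos_of_pos hγ0 _
  have hg1 : γ ^ k < 1 := Real.rpow_lt_one hγ0.le hγ1 hk0
  set δ := min (min γ (1-γ)) (min (γ^k) (1-γ^k)) with hδ
  have hδ0 : 0 < δ := by
    simp only [hδ, lt_min_iff]
    refine ⟨⟨?_, ?_⟩, ?_, ?_⟩ <;> linarith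
  have e1 : δ ≤ γ := (min_le_left _ _).trans (min_le_left _ _)
  have e2 : δ ≤ 1 - γ := (min_le_left _ _).trans (min_le_right _ _)
  have e3 : δ ≤ γ ^ k := (min_le_right _ _).trans (min_le_left _ _)
  have e4 : δ ≤ 1 - γ ^ k := (min_le_right _ _).trans (min_le_right _ _)
  have hdot : ∀ x β : EuclideanSpace ℝ (Fin d), dotp x β = inner ℝ x β := by
    intro x β
    simp [dotp, PiLp.inner_apply, mul_comm]
  refine ⟨- Real.log δ, ?_, ?_⟩
  · have := Real.log_nonpos hδ0.le (by linarith)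
    linarith
  · rintro x y (rfl | rfl)
    · simp only [lfun, hdot]
      simp only [Real.rpow_zero, sub_zero, Real.rpow_one, mul_one, one_mul]
      exact ⟨fun β => mix_bdd _ _ _ _ hδ0 e1 e3 hγ1.le hg1.le, fun β β' => mix_lip _ _ _ _ hγ0 hg0⟩
    · simp only [lfun, hdot]
      simp only [Real.rpow_zero, sub_self, Real.rpow_one, mul_one, mul_zero]
      exact ⟨fun β => mix_bdd _ _ _ _ hδ0 e2 e4 (by linarith) (by linarith),
        fun β β' => mix_lip _ _ _ _ (by linarith) (by linarith)⟩

lemma lfun_meas {d : ℕ} (γ k : ℝ) (β : EuclideanSpace ℝ (Fin d)) :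
    Measurable (fun p : EuclideanSpace ℝ (Fin d) × ℝ => lfun γ k p.1 p.2 β) := by
  unfold lfun dotp
  fun_prop

lemma lfun_meas' {Ω : Type*} [MeasurableSpace Ω] {d : ℕ} (γ k : ℝ) (β : EuclideanSpace ℝ (Fin d))
    (x : Ω → EuclideanSpace ℝ (Fin d)) (y : Ω → ℝ) (hx : Measurable x) (hy : Measurable y) :
    Measurable (fun ω => lfun γ k (x ω) (y ω) β) := by
  unfold lfun dotp
  fun_prop

lemma bddA {f : ℕ → ℝ} {K : ℝ} (h : ∀ n, |f n| ≤ K) : BddAbove (Set.range f) :=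
  ⟨K, by rintro _ ⟨n, rfl⟩; exact (abs_le.1 (h n)).2⟩

lemma abs_iSup_le' {f : ℕ → ℝ} {K : ℝ} (h : ∀ n, |f n| ≤ K) : |⨆ n, f n| ≤ K := by
  rw [abs_le]
  exact ⟨(abs_le.1 (h 0)).1.trans (le_ciSup (bddA h) 0), ciSup_le fun n => (abs_le.1 (h n)).2⟩

section gen
variable {Ω : Type*} [MeasurableSpace Ω]

lemma integrable_sup (μ : Measure Ω) {f : ℕ → Ω → ℝ} {g : Ω → ℝ}
    (hf : ∀ n, Measurable (f n)) (hg : Integrable g μ) (h : ∀ n ω, |f n ω| ≤ g ω) :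
    Integrable (fun ω => ⨆ n, f n ω) μ :=
  hg.mono' (Measurable.iSup hf).aestronglyMeasurable
    (Eventually.of_forall fun ω => abs_iSup_le' (fun n => h n ω))

variable {F : Type*} [NormedAddCommGroup F] [InnerProductSpace ℝ F] [MeasurableSpace F]
  [BorelSpace F] [SecondCountableTopology F]

lemma one_step (μ : Measure Ω) [IsProbabilityMeasure μ] (G : ℕ → ℝ) (K M R : ℝ)
    (hG : ∀ n, |G n| ≤ K) (Y : Ω → ℕ → ℝ) (hY : Measurable Y) (hM : ∀ ω n, |Y ω n| ≤ M)
    (u : Ω → F) (hu : Measurable u) (hui : Integrable (fun ω => ‖u ω‖) μ)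
    (b : ℕ → F) (hb : ∀ n, ‖b n‖ ≤ R)
    (hL : ∀ ω n n', |Y ω n - Y ω n'| ≤ |inner ℝ (u ω) (b n) - inner ℝ (u ω) (b n')|) :
    ∫ ω, (⨆ n, (G n + (Y ω n - ∫ ω', Y ω' n ∂μ))) ∂μ ≤
      ∫ ω, (1/2) * ((⨆ n, (G n + 2 * inner ℝ (u ω) (b n)))
        + (⨆ n, (G n + -(2 * inner ℝ (u ω) (b n))))) ∂μ := by
  have hYn : ∀ n, Measurable (fun ω => Y ω n) := fun n => (measurable_pi_apply n).comp hY
  have hYi : ∀ n, Integrable (fun ω => Y ω n) μ := fun n =>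
    (integrable_const M).mono' (hYn n).aestronglyMeasurable (Eventually.of_forall fun ω => hM ω n)
  have hin : ∀ n, Measurable (fun ω => (inner ℝ (u ω) (b n) : ℝ)) := fun n => by fun_prop
  have hA : ∀ n ω, |G n + 2 * Y ω n| ≤ K + 2 * M := fun n ω => by
    have := abs_le.1 (hG n); have := abs_le.1 (hM ω n)
    rw [abs_le]; constructor <;> linarith
  have hB : ∀ n ω, |G n + -(2 * Y ω n)| ≤ K + 2 * M := fun n ω => by
    have := abs_le.1 (hG n); have := abs_le.1 (hM ω n)
    rw [abs_le]; constructor <;> linarith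
  have hinb : ∀ n ω, |(inner ℝ (u ω) (b n) : ℝ)| ≤ ‖u ω‖ * R := fun n ω =>
    (abs_real_inner_le_norm _ _).trans (by gcongr; exact hb n)
  have hA' : ∀ n ω, |G n + 2 * inner ℝ (u ω) (b n)| ≤ K + 2 * (‖u ω‖ * R) := fun n ω => by
    have := abs_le.1 (hG n); have := abs_le.1 (hinb n ω)
    rw [abs_le]; constructor <;> linarith
  have hB' : ∀ n ω, |G n + -(2 * inner ℝ (u ω) (b n))| ≤ K + 2 * (‖u ω‖ * R) := fun n ω => by
    have := abs_le.1 (hG n); have := abs_le.1 (hinb n ω)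
    rw [abs_le]; constructor <;> linarith
  have iA := integrable_sup μ (f := fun n ω => G n + 2 * Y ω n)
    (fun n => by have := hYn n; fun_prop) (integrable_const (K + 2 * M)) hA
  have iB := integrable_sup μ (f := fun n ω => G n + -(2 * Y ω n))
    (fun n => by have := hYn n; fun_prop) (integrable_const (K + 2 * M)) hB
  have hgi : Integrable (fun ω => K + 2 * (‖u ω‖ * R)) μ :=
    (integrable_const K).add ((hui.mul_const R).const_mul 2)
  have iA' := integrable_sup μ (f := fun n ω => G n + 2 * inner ℝ (u ω) (b n))
    (fun n => by have := hin n; fun_prop) hgi hA'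
  have iB' := integrable_sup μ (f := fun n ω => G n + -(2 * inner ℝ (u ω) (b n)))
    (fun n => by have := hin n; fun_prop) hgi hB'
  have hEY : ∀ n, |∫ ω', Y ω' n ∂μ| ≤ M := fun n => by
    have := norm_integral_le_of_norm_le_const (μ := μ) (f := fun ω => Y ω n) (C := M)
      (Eventually.of_forall fun ω => hM ω n)
    simpa using this
  have iL := integrable_sup μ (f := fun n ω => G n + (Y ω n - ∫ ω', Y ω' n ∂μ))
    (fun n => by have := hYn n; fun_prop) (integrable_const (K + 2 * M)) (fun n ω => by
      have := abs_le.1 (hG n); have := abs_le.1 (hM ω n); have := abs_le.1 (hEY n)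
      rw [abs_le]; constructor <;> linarith)
  calc _ ≤ ∫ ω, ((1/2) * (⨆ n, (G n + 2 * Y ω n))
        + (1/2) * ∫ ω', (⨆ n, (G n + -(2 * Y ω' n))) ∂μ) ∂μ := by
        refine integral_mono iL ((iA.const_mul _).add (integrable_const _)) fun ω => ?_
        refine ciSup_le fun n => ?_
        have h1 : ∫ ω', (G n + (Y ω n - Y ω' n)) ∂μ ≤
            ∫ ω', ((1/2) * (⨆ n, (G n + 2 * Y ω n)) + (1/2) * (⨆ n, (G n + -(2 * Y ω' n)))) ∂μ := by
          refine integral_mono ((integrable_const _).add ((integrable_const _).sub (hYi n)))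
            ((integrable_const _).add (iB.const_mul _)) fun ω' => ?_
          have e1 := le_ciSup (bddA (fun n => hA n ω)) n
          have e2 := le_ciSup (bddA (fun n => hB n ω')) n
          simp only at e1 e2 ⊢
          linarith
        have hsub : Integrable (fun ω' => Y ω n - Y ω' n) μ := (integrable_const _).sub (hYi n)
        rw [integral_add (integrable_const _) hsub,
          integral_sub (integrable_const _) (hYi n),
          integral_add (integrable_const _) (iB.const_mul _),
          integral_const_mul (1/2) (fun ω' => ⨆ n, (G n + -(2 * Y ω' n)))] at h1
        simpa using h1
    _ = ∫ ω, (1/2) * ((⨆ n, (G n + 2 * Y ω n)) + (⨆ n, (G n + -(2 * Y ω n)))) ∂μ := by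
        rw [integral_const_mul, integral_add iA iB,
          integral_add (iA.const_mul _) (integrable_const _), integral_const_mul]
        simp
        ring
    _ ≤ _ := by
        refine integral_mono ((iA.add iB).const_mul _) ((iA'.add iB').const_mul _) fun ω => ?_
        gcongr (1/2) * ?_
        have key : ∀ n n', (G n + 2 * Y ω n) + (G n' + -(2 * Y ω n')) ≤
            ((⨆ n, (G n + 2 * inner ℝ (u ω) (b n)))
        + (⨆ n, (G n + -(2 * inner ℝ (u ω) (b n))))) := by
          intro n n'
          have h := (le_abs_self _).trans (hL ω n n')
          have e1 := le_ciSup (bddA (fun n => hA' n ω)) n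
          have e2 := le_ciSup (bddA (fun n => hB' n ω)) n'
          have e3 := le_ciSup (bddA (fun n => hA' n ω)) n'
          have e4 := le_ciSup (bddA (fun n => hB' n ω)) n
          rcases abs_cases ((inner ℝ (u ω) (b n) : ℝ) - inner ℝ (u ω) (b n')) with h' | h'
          · linarith
          · linarith
        have : (⨆ n, (G n + 2 * Y ω n)) ≤ ((⨆ n, (G n + 2 * inner ℝ (u ω) (b n)))
            + (⨆ n, (G n + -(2 * inner ℝ (u ω) (b n))))) - (⨆ n, (G n + -(2 * Y ω n))) := by
          refine ciSup_le fun n => ?_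
          rw [le_sub_comm]
          refine ciSup_le fun n' => ?_
          linarith [key n n']
        linarith

lemma main_bound (μ : Measure Ω) [IsProbabilityMeasure μ] (M R a : ℝ) (hR : 0 ≤ R) (ha : 0 < a)
    (Y : ℕ → Ω → ℕ → ℝ) (hY : ∀ i, Measurable (Y i)) (hM : ∀ i ω n, |Y i ω n| ≤ M)
    (hind : iIndepFun Y μ)
    (u : ℕ → Ω → F) (hu : ∀ i, Measurable (u i)) (hui : ∀ i, Integrable (fun ω => ‖u i ω‖ ^ 2) μ)
    (b : ℕ → F) (hb : ∀ n, ‖b n‖ ≤ R)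
    (hL : ∀ i ω n n', |Y i ω n - Y i ω n'| ≤ |inner ℝ (u i ω) (b n) - inner ℝ (u i ω) (b n')|)
    (m : ℕ) : ∀ v : F,
    ∫ ω, (⨆ n, (inner ℝ v (b n) + ∑ i ∈ Finset.range m, (Y i ω n - ∫ ω', Y i ω' n ∂μ))) ∂μ ≤
      R / 2 * (a + (‖v‖ ^ 2 + 4 * ∑ i ∈ Finset.range m, ∫ ω, ‖u i ω‖ ^ 2 ∂μ) / a) := by
  have hvb : ∀ (v : F) n, |(inner ℝ v (b n) : ℝ)| ≤ ‖v‖ * R := fun v n =>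
    (abs_real_inner_le_norm _ _).trans (by gcongr; exact hb n)
  induction m with
  | zero =>
    intro v
    simp only [Finset.range_zero, Finset.sum_empty, add_zero, integral_const, probReal_univ,
      one_smul, mul_zero]
    refine (ciSup_le fun n => (le_abs_self _).trans (hvb v n)).trans ?_
    have : ‖v‖ ≤ 1 / 2 * (a + ‖v‖ ^ 2 / a) := by
      have h : a + ‖v‖ ^ 2 / a - 2 * ‖v‖ = (a - ‖v‖) ^ 2 / a := by field_simp; ring
      have h2 : 0 ≤ (a - ‖v‖) ^ 2 / a := by positivity
      linarith
    nlinarith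
  | succ m ih =>
    intro v
    have hYn : ∀ i n, Measurable (fun ω => Y i ω n) :=
      fun i n => (measurable_pi_apply n).comp (hY i)
    have hEY : ∀ i n, |∫ ω', Y i ω' n ∂μ| ≤ M := fun i n => by
      have := norm_integral_le_of_norm_le_const (μ := μ) (f := fun ω => Y i ω n) (C := M)
        (Eventually.of_forall fun ω => hM i ω n)
      simpa using this
    have huin : Integrable (fun ω => ‖u m ω‖) μ := by
      refine ((integrable_const (1:ℝ)).add (hui m)).mono' (hu m).norm.aestronglyMeasurable
        (Eventually.of_forall fun ω => ?_)
      simp only [Pi.add_apply, norm_norm]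
      nlinarith [sq_nonneg (‖u m ω‖ - 1), norm_nonneg (u m ω)]
    let S : Ω → ℕ → ℝ := ∑ i ∈ Finset.range m, Y i
    let c : ℕ → ℕ → ℝ := fun i n => ∫ ω', Y i ω' n ∂μ
    let D : Ω → ℕ → ℝ := fun ω n => ∑ i ∈ Finset.range m, (Y i ω n - c i n)
    have hSD : ∀ ω n, S ω n - ∑ i ∈ Finset.range m, c i n = D ω n := fun ω n => by
      simp [S, D, Finset.sum_apply, Finset.sum_sub_distrib]
    have hDn : ∀ n, Measurable (fun ω => D ω n) := fun n =>
      Finset.measurable_fun_sum _ fun i _ => (hYn i n).sub_const _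
    have hSm : Measurable S := by
      have h := Finset.measurable_sum (f := Y) (Finset.range m) fun i _ => hY i
      have e : S = fun ω => ∑ i ∈ Finset.range m, Y i ω := by
        ext1 ω; simp only [S, Finset.sum_apply]
      rw [e]; exact h
    have hDb : ∀ ω n, |D ω n| ≤ m * (2 * M) := fun ω n => by
      refine (Finset.abs_sum_le_sum_abs _ _).trans ?_
      refine (Finset.sum_le_card_nsmul _ _ (2 * M) fun i _ => ?_).trans (by simp)
      have := abs_le.1 (hM i ω n); have := abs_le.1 (hEY i n)
      rw [abs_le]; constructor <;> simp only [c] <;> linarith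
    have hSY : IndepFun S (Y m) μ := hind.indepFun_sum_range_succ hY m
    -- decoupling
    let Φ : (ℕ → ℝ) × (ℕ → ℝ) → ℝ := fun p =>
      ⨆ n, ((inner ℝ v (b n) + (p.1 n - ∑ i ∈ Finset.range m, c i n)) + (p.2 n - c m n))
    have hΦ : Measurable Φ := Measurable.iSup fun n => by fun_prop
    have hmap : μ.map (fun ω => (S ω, Y m ω)) = (μ.prod μ).map (Prod.map S (Y m)) := by
      rw [hSY.map_prod_eq_prod_map_map hSm.aemeasurable (hY m).aemeasurable,
        Measure.map_prod_map _ _ hSm (hY m)]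
    have hdec : ∫ ω, Φ (S ω, Y m ω) ∂μ = ∫ p, Φ (S p.1, Y m p.2) ∂(μ.prod μ) := by
      have h1 := integral_map (μ := μ) (φ := fun ω => (S ω, Y m ω))
        (hSm.prodMk (hY m)).aemeasurable (f := Φ) hΦ.aestronglyMeasurable
      have h2 := integral_map (μ := μ.prod μ) (φ := Prod.map S (Y m))
        (hSm.prodMap (hY m)).aemeasurable (f := Φ) hΦ.aestronglyMeasurable
      rw [← h1, hmap, h2]
      rfl
    have hΦi : Integrable (fun p : Ω × Ω => Φ (S p.1, Y m p.2)) (μ.prod μ) := by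
      refine (integrable_const (‖v‖ * R + m * (2 * M) + 2 * M)).mono'
        (hΦ.comp ((hSm.comp measurable_fst).prodMk
          ((hY m).comp measurable_snd))).aestronglyMeasurable
        (Eventually.of_forall fun p => ?_)
      refine abs_iSup_le' fun n => ?_
      simp only [hSD]
      have := abs_le.1 (hM m p.2 n); have := abs_le.1 (hEY m n)
      have := abs_le.1 (hDb p.1 n); have := abs_le.1 (hvb v n)
      rw [abs_le]; constructor <;> simp only [c] <;> linarith
    have hPi : ∀ s : ℝ, |s| ≤ 2 → Integrable (fun p : Ω × Ω =>
        ⨆ n, ((inner ℝ v (b n) + D p.1 n) + s * inner ℝ (u m p.2) (b n))) (μ.prod μ) := by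
      intro s hs
      refine integrable_sup _ (g := fun p : Ω × Ω =>
        (‖v‖ * R + m * (2 * M)) + 2 * (‖u m p.2‖ * R)) (fun n => ?_) ?_ ?_
      · have h1 : Measurable (fun p : Ω × Ω => D p.1 n) := (hDn n).comp measurable_fst
        have h2 : Measurable (fun p : Ω × Ω => (inner ℝ (u m p.2) (b n) : ℝ)) := by
          have := hu m
          fun_prop
        exact (h1.const_add _).add (h2.const_mul s)
      · exact (integrable_const _).add (((huin.comp_snd μ).mul_const R).const_mul 2)
      · intro n p
        have e3 : |s * inner ℝ (u m p.2) (b n)| ≤ 2 * (‖u m p.2‖ * R) := by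
          rw [abs_mul]; gcongr; exact hvb _ n
        have := abs_le.1 e3
        have := abs_le.1 (hDb p.1 n); have := abs_le.1 (hvb v n)
        rw [abs_le]; constructor <;> linarith
    have hstep : ∀ s : ℝ, |s| ≤ 2 → ∀ ω', 
        ∫ ω, (⨆ n, ((inner ℝ v (b n) + D ω n) + s * inner ℝ (u m ω') (b n))) ∂μ ≤
        R / 2 * (a + (‖v + s • u m ω'‖ ^ 2
          + 4 * ∑ i ∈ Finset.range m, ∫ ω, ‖u i ω‖ ^ 2 ∂μ) / a) := by
      intro s hs ω'
      refine le_trans (le_of_eq ?_) (ih (v + s • u m ω'))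
      congr 1; ext ω; congr 1; ext n
      simp only [D, c, inner_add_left, real_inner_smul_left]
      ring
    have h2 : |(2:ℝ)| ≤ 2 := by norm_num
    have h2' : |(-2:ℝ)| ≤ 2 := by norm_num
    calc _ = ∫ ω, Φ (S ω, Y m ω) ∂μ := by
          congr 1; ext ω
          simp only [Φ]
          congr 1; ext n
          rw [Finset.sum_range_succ, hSD]
          simp only [D, c]; ring
      _ = ∫ ω, ∫ ω', Φ (S ω, Y m ω') ∂μ ∂μ := by
          rw [hdec, integral_prod _ hΦi]
      _ ≤ ∫ ω, ∫ ω', (1/2) * ((⨆ n, ((inner ℝ v (b n) + D ω n) + 2 * inner ℝ (u m ω') (b n)))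
        + (⨆ n, ((inner ℝ v (b n) + D ω n) + (-2) * inner ℝ (u m ω') (b n)))) ∂μ ∂μ := by
          refine integral_mono hΦi.integral_prod_left
            (((hPi 2 h2).add (hPi (-2) h2')).const_mul (1/2)).integral_prod_left fun ω => ?_
          have := one_step μ (fun n => inner ℝ v (b n) + D ω n) (‖v‖ * R + m * (2 * M)) M R
            (fun n => by
              have := abs_le.1 (hDb ω n); have := abs_le.1 (hvb v n)
              rw [abs_le]; constructor <;> linarith) (Y m) (hY m) (hM m) (u m) (hu m) huin b hb
              (hL m)
          simp only [Φ, hSD, neg_mul]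
          exact this
      _ = ∫ ω', ∫ ω, (1/2) * ((⨆ n, ((inner ℝ v (b n) + D ω n) + 2 * inner ℝ (u m ω') (b n)))
        + (⨆ n, ((inner ℝ v (b n) + D ω n) + (-2) * inner ℝ (u m ω') (b n)))) ∂μ ∂μ :=
          integral_integral_swap (((hPi 2 h2).add (hPi (-2) h2')).const_mul (1/2))
      _ ≤ ∫ ω', R / 2 * (a + (‖v‖ ^ 2 + 4 * ‖u m ω'‖ ^ 2
          + 4 * ∑ i ∈ Finset.range m, ∫ ω, ‖u i ω‖ ^ 2 ∂μ) / a) ∂μ := by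
          have hae : ∀ s : ℝ, |s| ≤ 2 → ∀ ω', Integrable (fun ω => 
              ⨆ n, ((inner ℝ v (b n) + D ω n) + s * inner ℝ (u m ω') (b n))) μ := by
            intro s hs ω'
            refine integrable_sup _ (g := fun ω =>
              (‖v‖ * R + m * (2 * M)) + 2 * (‖u m ω'‖ * R)) (fun n => ?_) (integrable_const _) ?_
            · exact ((hDn n).const_add _).add_const _
            · intro n p
              have e3 : |s * inner ℝ (u m ω') (b n)| ≤ 2 * (‖u m ω'‖ * R) := by
                rw [abs_mul]; gcongr; exact hvb _ n
              have := abs_le.1 e3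
              have := abs_le.1 (hDb p n); have := abs_le.1 (hvb v n)
              rw [abs_le]; constructor <;> linarith
          refine integral_mono (((hPi 2 h2).add (hPi (-2) h2')).const_mul (1/2)).integral_prod_right
            ?_ fun ω' => ?_
          · refine Integrable.const_mul ((integrable_const a).add (Integrable.div_const ?_ a)) _
            exact ((integrable_const _).add ((hui m).const_mul 4)).add (integrable_const _)
          · simp only
            rw [integral_const_mul, integral_add (hae 2 h2 ω') (hae (-2) h2' ω')]
            have e1 := hstep 2 h2 ω'
            have e2 := hstep (-2) h2' ω'
            have e3 : ‖v + (2:ℝ) • u m ω'‖ ^ 2 + ‖v + (-2:ℝ) • u m ω'‖ ^ 2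
                = 2 * (‖v‖ ^ 2 + 4 * ‖u m ω'‖ ^ 2) := by
              rw [norm_add_sq_real, norm_add_sq_real, inner_smul_right, inner_smul_right,
                norm_smul, norm_smul]
              norm_num
              ring
            refine (mul_le_mul_of_nonneg_left (add_le_add e1 e2) (by norm_num)).trans (le_of_eq ?_)
            have e4 : ‖v + (2:ℝ) • u m ω'‖ ^ 2 = 
              2 * (‖v‖ ^ 2 + 4 * ‖u m ω'‖ ^ 2) - ‖v + (-2:ℝ) • u m ω'‖ ^ 2 := by linarith
            rw [e4]
            ring
      _ = _ := by
          rw [integral_const_mul, integral_add (integrable_const _), integral_div,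
            integral_add _ (integrable_const _), integral_add (integrable_const _),
            integral_const_mul, Finset.sum_range_succ]
          · simp; left; ring
          · exact (hui m).const_mul 4
          · exact (integrable_const _).add ((hui m).const_mul 4)
          · exact (((integrable_const _).add ((hui m).const_mul 4)).add
              (integrable_const _)).div_const a

lemma abs_bound (μ : Measure Ω) [IsProbabilityMeasure μ] (M R C : ℝ) (hR : 0 ≤ R)
    (Y : ℕ → Ω → ℕ → ℝ) (hY : ∀ i, Measurable (Y i)) (hM : ∀ i ω n, |Y i ω n| ≤ M)
    (hind : iIndepFun Y μ)
    (u : ℕ → Ω → F) (hu : ∀ i, Measurable (u i)) (hui : ∀ i, Integrable (fun ω => ‖u i ω‖ ^ 2) μ)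
    (huC : ∀ i, ∫ ω, ‖u i ω‖ ^ 2 ∂μ ≤ C)
    (b : ℕ → F) (hb : ∀ n, ‖b n‖ ≤ R)
    (hL : ∀ i ω n n', |Y i ω n - Y i ω n'| ≤ |inner ℝ (u i ω) (b n) - inner ℝ (u i ω) (b n')|)
    (m : ℕ) (hm : 0 < m) :
    Integrable (fun ω => ⨆ n, |∑ i ∈ Finset.range m, (Y i ω n - ∫ ω', Y i ω' n ∂μ)|) μ ∧
    ∫ ω, (⨆ n, |∑ i ∈ Finset.range m, (Y i ω n - ∫ ω', Y i ω' n ∂μ)|) ∂μ ≤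
      (R * (1 + 4 * C) + (1 + 4 * M ^ 2) / 2) * Real.sqrt m := by
  have hYn : ∀ i n, Measurable (fun ω => Y i ω n) :=
    fun i n => (measurable_pi_apply n).comp (hY i)
  have hEY : ∀ i n, |∫ ω', Y i ω' n ∂μ| ≤ M := fun i n => by
    have := norm_integral_le_of_norm_le_const (μ := μ) (f := fun ω => Y i ω n) (C := M)
      (Eventually.of_forall fun ω => hM i ω n)
    simpa using this
  let A : Ω → ℕ → ℝ := fun ω n => ∑ i ∈ Finset.range m, (Y i ω n - ∫ ω', Y i ω' n ∂μ)
  have hAn : ∀ n, Measurable (fun ω => A ω n) := fun n =>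
    Finset.measurable_fun_sum _ fun i _ => (hYn i n).sub_const _
  have hAb : ∀ ω n, |A ω n| ≤ m * (2 * M) := fun ω n => by
    refine (Finset.abs_sum_le_sum_abs _ _).trans ?_
    refine (Finset.sum_le_card_nsmul _ _ (2 * M) fun i _ => ?_).trans (by simp)
    have := abs_le.1 (hM i ω n); have := abs_le.1 (hEY i n)
    rw [abs_le]; constructor <;> linarith
  have hAb' : ∀ ω n, |-A ω n| ≤ m * (2 * M) := fun ω n => by rw [abs_neg]; exact hAb ω n
  have hm' : (0:ℝ) < m := by exact_mod_cast hm
  have ha : 0 < Real.sqrt m := Real.sqrt_pos.2 hm'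
  have hsq : Real.sqrt m * Real.sqrt m = m := Real.mul_self_sqrt hm'.le
  have i0 : Integrable (fun ω => ⨆ n, |A ω n|) μ :=
    integrable_sup μ (f := fun n ω => |A ω n|) (fun n => (hAn n).abs)
      (integrable_const (m * (2 * M))) (fun n ω => by rw [abs_abs]; exact hAb ω n)
  have i1 : Integrable (fun ω => ⨆ n, A ω n) μ :=
    integrable_sup μ (f := fun n ω => A ω n) hAn
      (integrable_const (m * (2 * M))) (fun n ω => hAb ω n)
  have i2 : Integrable (fun ω => ⨆ n, -A ω n) μ :=
    integrable_sup μ (f := fun n ω => -A ω n) (fun n => (hAn n).neg)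
      (integrable_const (m * (2 * M))) (fun n ω => hAb' ω n)
  have i3 : Integrable (fun ω => |A ω 0|) μ :=
    (integrable_const (m * (2 * M))).mono' (hAn 0).abs.aestronglyMeasurable
      (Eventually.of_forall fun ω => by rw [Real.norm_eq_abs, abs_abs]; exact hAb ω 0)
  have hsum : ∀ (f : ℕ → ℝ) (K : ℝ), (∀ i, f i ≤ K) →
      (0 + 4 * ∑ i ∈ Finset.range m, f i) / Real.sqrt m ≤ 4 * K * Real.sqrt m := by
    intro f K hf
    rw [div_le_iff₀ ha, mul_assoc, hsq]
    have := Finset.sum_le_card_nsmul (Finset.range m) f K (fun i _ => hf i)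
    simp at this
    linarith
  have b1 : ∫ ω, (⨆ n, A ω n) ∂μ ≤ R / 2 * ((1 + 4 * C) * Real.sqrt m) := by
    have h := main_bound μ M R (Real.sqrt m) hR ha Y hY hM hind u hu hui b hb hL m 0
    simp only [inner_zero_left, zero_add, norm_zero] at h
    refine h.trans (mul_le_mul_of_nonneg_left ?_ (by positivity))
    have := hsum _ C huC
    simp only [zero_add] at this
    norm_num
    linarith
  have b2 : ∫ ω, (⨆ n, -A ω n) ∂μ ≤ R / 2 * ((1 + 4 * C) * Real.sqrt m) := by
    have h := main_bound μ M R (Real.sqrt m) hR ha (fun i ω n => - Y i ω n)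
      (fun i => measurable_pi_lambda _ fun n => (hYn i n).neg)
      (fun i ω n => by rw [abs_neg]; exact hM i ω n)
      (hind.comp (fun _ f n => - f n) (fun i => by fun_prop)) u hu hui b hb
      (fun i ω n n' => by
        rw [← neg_sub', abs_neg]; exact hL i ω n n') m 0
    simp only [inner_zero_left, zero_add, norm_zero] at h
    refine le_trans (le_of_eq ?_) (h.trans (mul_le_mul_of_nonneg_left ?_ (by positivity)))
    · congr 1; ext ω; congr 1; ext n
      simp only [A, integral_neg, ← Finset.sum_neg_distrib]
      exact Finset.sum_congr rfl fun i _ => by ring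
    have := hsum _ C huC
    simp only [zero_add] at this
    norm_num
    linarith
  have b3 : ∫ ω, |A ω 0| ∂μ ≤ 1 / 2 * ((1 + 4 * M ^ 2) * Real.sqrt m) := by
    let s : ℕ → ℝ := fun n => if n = 0 then 1 else -1
    have hs : ∀ n, |s n| = 1 := fun n => by simp only [s]; split_ifs <;> simp
    have h := main_bound μ M 1 (Real.sqrt m) zero_le_one ha (fun i ω n => s n * Y i ω 0)
      (fun i => measurable_pi_lambda _ fun n => (hYn i 0).const_mul _)
      (fun i ω n => by rw [abs_mul, hs, one_mul]; exact hM i ω 0)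
      (hind.comp (fun _ f n => s n * f 0) (fun i => by fun_prop)) (F := ℝ) (fun _ _ => M)
      (fun _ => measurable_const) (fun _ => integrable_const _) s (fun n => (hs n).le)
      (fun i ω n n' => by
        rw [← sub_mul, real_inner_comm, real_inner_comm (s n')]
        simp only [RCLike.inner_apply, conj_trivial]
        rw [← mul_sub, abs_mul, abs_mul, mul_comm]
        exact mul_le_mul_of_nonneg_right ((hM i ω 0).trans (le_abs_self _)) (abs_nonneg _)) m 0
    simp only [inner_zero_left, zero_add, norm_zero] at h
    refine le_trans (integral_mono i3 ?_ fun ω => ?_)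
      (h.trans (mul_le_mul_of_nonneg_left ?_ (by norm_num)))
    · have e : ∀ n ω, ∑ i ∈ Finset.range m, (s n * Y i ω 0 - ∫ ω', s n * Y i ω' 0 ∂μ)
          = s n * A ω 0 := by
        intro n ω
        simp only [A, integral_const_mul, Finset.mul_sum, mul_sub]
      simp only [e]
      exact integrable_sup μ (f := fun n ω => s n * A ω 0) (fun n => (hAn 0).const_mul _)
        (integrable_const (m * (2 * M))) (fun n ω => by rw [abs_mul, hs, one_mul]; exact hAb ω 0)
    · have e : ∀ n ω, ∑ i ∈ Finset.range m, (s n * Y i ω 0 - ∫ ω', s n * Y i ω' 0 ∂μ)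
          = s n * A ω 0 := by
        intro n ω
        simp only [A, integral_const_mul, Finset.mul_sum, mul_sub]
      simp only [e]
      have hbd : ∀ n, |s n * A ω 0| ≤ m * (2 * M) := fun n => by
        rw [abs_mul, hs, one_mul]; exact hAb ω 0
      have e0 := le_ciSup (bddA hbd) 0
      have e1 := le_ciSup (bddA hbd) 1
      have s0 : s 0 = 1 := rfl
      have s1 : s 1 = -1 := rfl
      simp only [s0, s1, one_mul, neg_mul] at e0 e1
      exact abs_le'.2 ⟨e0, e1⟩
    have := hsum (fun _ => M ^ 2) (M ^ 2) (fun _ => le_rfl)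
    simp only [zero_add] at this
    simp
    simp at this
    linarith
  refine ⟨i0, ?_⟩
  calc ∫ ω, (⨆ n, |A ω n|) ∂μ ≤ ∫ ω, (((⨆ n, A ω n) + (⨆ n, -A ω n)) + |A ω 0|) ∂μ := by
        refine integral_mono i0 ((i1.add i2).add i3) fun ω => ciSup_le fun n => ?_
        have e1 := le_ciSup (bddA (hAb ω)) n
        have e2 := le_ciSup (bddA (hAb' ω)) n
        have e3 := le_ciSup (bddA (hAb ω)) 0
        have e4 := le_ciSup (bddA (hAb' ω)) 0
        have := neg_abs_le (A ω 0)
        have := le_abs_self (A ω 0)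
        show |A ω n| ≤ ((⨆ n, A ω n) + (⨆ n, -A ω n)) + |A ω 0|
        rw [abs_le]; constructor <;> linarith
    _ ≤ _ := by
        have i12 : Integrable (fun ω => (⨆ n, A ω n) + (⨆ n, -A ω n)) μ := i1.add i2
        rw [integral_add i12 i3, integral_add i1 i2]
        linarith

end gen

/-- `P_m l(β) = m⁻¹ Σ_{i<m} l(β; z_i)`. -/
def Pml {Ω : Type*} {d : ℕ} (γ k : ℝ) (x : ℕ → Ω → EuclideanSpace ℝ (Fin d))
    (y : ℕ → Ω → ℝ) (m : ℕ) (ω : Ω) (β : EuclideanSpace ℝ (Fin d)) : ℝ :=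
  (m : ℝ)⁻¹ * ∑ i ∈ Finset.range m, lfun γ k (x i ω) (y i ω) β

/-- `E[sup_{β∈B} |P_m l(β) − E P_m l(β)|] = O(m^{−1/2})`. -/
theorem stmt_9 {Ω : Type*} [MeasurableSpace Ω] (μ : Measure Ω) [IsProbabilityMeasure μ]
    {d : ℕ} (γ k : ℝ) (hγ : γ ∈ Set.Ioo (0:ℝ) 1) (hk : k ∈ Set.Ioo (0:ℝ) 1)
    (B : Set (EuclideanSpace ℝ (Fin d))) (hB : IsCompact B)
    (x : ℕ → Ω → EuclideanSpace ℝ (Fin d)) (y : ℕ → Ω → ℝ)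
    (hxmeas : ∀ i, Measurable (x i)) (hymeas : ∀ i, Measurable (y i))
    (hy01 : ∀ i ω, y i ω = 0 ∨ y i ω = 1)
    (hindep : iIndepFun (fun i ω => (x i ω, y i ω)) μ)
    (hmomInt : ∀ i, Integrable (fun ω => ‖x i ω‖ ^ 2) μ)
    (hmom : ∃ C : ℝ, ∀ i, (∫ ω, ‖x i ω‖ ^ 2 ∂μ) ≤ C) :
    ∃ C : ℝ, ∀ᶠ m : ℕ in atTop,
      (∫ ω, (⨆ β : B, |Pml γ k x y m ω β.1 - ∫ ω', Pml γ k x y m ω' β.1 ∂μ|) ∂μ)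
        ≤ C * (m : ℝ) ^ (-(1/2 : ℝ)) := by
  obtain ⟨C, hC⟩ := hmom
  rcases B.eq_empty_or_nonempty with hBe | hBne
  · subst hBe
    refine ⟨0, Eventually.of_forall fun m => ?_⟩
    simp
  obtain ⟨M, hM0, hlf⟩ := lfun_facts (d := d) γ k hγ hk
  obtain ⟨R, hR⟩ := hB.isBounded.exists_norm_le
  have : Nonempty B := hBne.to_subtype
  obtain ⟨e, he⟩ := TopologicalSpace.exists_dense_seq B
  let b : ℕ → EuclideanSpace ℝ (Fin d) := fun n => (e n).1
  have hb : ∀ n, ‖b n‖ ≤ R := fun n => hR _ (e n).2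
  have hR0 : 0 ≤ R := (norm_nonneg _).trans (hb 0)
  have hlm : ∀ i β, Measurable (fun ω => lfun γ k (x i ω) (y i ω) β) := fun i β =>
    lfun_meas' γ k β (x i) (y i) (hxmeas i) (hymeas i)
  have hlb : ∀ i ω β, |lfun γ k (x i ω) (y i ω) β| ≤ M := fun i ω β =>
    (hlf (x i ω) (y i ω) (hy01 i ω)).1 β
  have hli : ∀ i β, Integrable (fun ω => lfun γ k (x i ω) (y i ω) β) μ := by
    intro i β
    refine (integrable_const M).mono' (hlm i β).aestronglyMeasurable
      (Eventually.of_forall fun ω => ?_)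
    rw [Real.norm_eq_abs]
    exact hlb i ω β
  have hlc : ∀ i ω, Continuous (fun β => lfun γ k (x i ω) (y i ω) β) := by
    intro i ω
    rw [continuous_iff_continuousAt]
    intro β
    rw [ContinuousAt, tendsto_iff_dist_tendsto_zero]
    have hc : Continuous (fun β' : EuclideanSpace ℝ (Fin d) =>
      |(inner ℝ (x i ω) β' : ℝ) - inner ℝ (x i ω) β|) := by fun_prop
    have := hc.tendsto β
    simp only [sub_self, abs_zero] at this
    exact squeeze_zero (fun _ => dist_nonneg) (fun β' => (hlf _ _ (hy01 i ω)).2 β' β) this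
  have hec : ∀ i, Continuous (fun β => ∫ ω, lfun γ k (x i ω) (y i ω) β ∂μ) := fun i =>
    continuous_of_dominated (bound := fun _ => M) (fun β => (hlm i β).aestronglyMeasurable)
      (fun β => Eventually.of_forall fun ω => hlb i ω β) (integrable_const M)
      (Eventually.of_forall fun ω => hlc i ω)
  let Y : ℕ → Ω → ℕ → ℝ := fun i ω n => lfun γ k (x i ω) (y i ω) (b n)
  refine ⟨R * (1 + 4 * C) + (1 + 4 * M ^ 2) / 2, ?_⟩
  filter_upwards [eventually_gt_atTop 0] with m hm
  have hm' : (0:ℝ) < m := by exact_mod_cast hm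
  obtain ⟨hint, hbd⟩ := abs_bound μ M R C hR0 Y
    (fun i => measurable_pi_lambda _ fun n => hlm i (b n))
    (fun i ω n => hlb i ω (b n))
    (hindep.comp (fun _ p n => lfun γ k p.1 p.2 (b n))
      (fun _ => measurable_pi_lambda _ fun n => lfun_meas γ k (b n)))
    x hxmeas hmomInt hC b hb (fun i ω n n' => (hlf _ _ (hy01 i ω)).2 (b n) (b n')) m hm
  have hP : ∀ ω β, Pml γ k x y m ω β - ∫ ω', Pml γ k x y m ω' β ∂μ = (m:ℝ)⁻¹ *
      ∑ i ∈ Finset.range m, (lfun γ k (x i ω) (y i ω) β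
        - ∫ ω', lfun γ k (x i ω') (y i ω') β ∂μ) := by
    intro ω β
    simp only [Pml]
    rw [integral_const_mul, integral_finsetSum _ (fun i _ => hli i β), Finset.sum_sub_distrib]
    ring
  have hEY : ∀ i β, |∫ ω', lfun γ k (x i ω') (y i ω') β ∂μ| ≤ M := fun i β => by
    have := norm_integral_le_of_norm_le_const (μ := μ)
      (f := fun ω => lfun γ k (x i ω) (y i ω) β) (C := M)
      (Eventually.of_forall fun ω => hlb i ω β)
    simpa using this
  have hpt : ∀ ω, (⨆ β : B, |Pml γ k x y m ω β.1 - ∫ ω', Pml γ k x y m ω' β.1 ∂μ|) ≤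
      (m:ℝ)⁻¹ * ⨆ n, |∑ i ∈ Finset.range m, (Y i ω n - ∫ ω', Y i ω' n ∂μ)| := by
    intro ω
    have hcont : Continuous (fun β : B => |Pml γ k x y m ω β.1
        - ∫ ω', Pml γ k x y m ω' β.1 ∂μ|) := by
      simp only [hP]
      refine (continuous_const.mul (continuous_finsetSum _ fun i _ => ?_)).abs
      exact ((hlc i ω).comp continuous_subtype_val).sub ((hec i).comp continuous_subtype_val)
    refine ciSup_le fun β => ?_
    have hcl := isClosed_le hcont (continuous_const (y := (m:ℝ)⁻¹ *
      ⨆ n, |∑ i ∈ Finset.range m, (Y i ω n - ∫ ω', Y i ω' n ∂μ)|))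
    have hsub : Set.range e ⊆ {β : B | |Pml γ k x y m ω β.1
        - ∫ ω', Pml γ k x y m ω' β.1 ∂μ| ≤ (m:ℝ)⁻¹ *
      ⨆ n, |∑ i ∈ Finset.range m, (Y i ω n - ∫ ω', Y i ω' n ∂μ)|} := by
      rintro _ ⟨n, rfl⟩
      simp only [Set.mem_ofPred_eq, hP]
      rw [abs_mul, abs_of_pos (inv_pos.2 hm')]
      refine mul_le_mul_of_nonneg_left ?_ (by positivity)
      refine le_ciSup (f := fun n => |∑ i ∈ Finset.range m, (Y i ω n - ∫ ω', Y i ω' n ∂μ)|)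
        ⟨m * (2 * M), ?_⟩ n
      rintro _ ⟨n, rfl⟩
      refine (Finset.abs_sum_le_sum_abs _ _).trans ?_
      refine (Finset.sum_le_card_nsmul _ _ (2 * M) fun i _ => ?_).trans (by simp)
      have := abs_le.1 (hlb i ω (b n)); have := abs_le.1 (hEY i (b n))
      rw [abs_le]; constructor <;> simp only [Y] <;> linarith
    have := hcl.closure_subset_iff.2 hsub
    rw [he.closure_range] at this
    exact this (Set.mem_univ β)
  calc _ ≤ ∫ ω, (m:ℝ)⁻¹ * ⨆ n, |∑ i ∈ Finset.range m, (Y i ω n - ∫ ω', Y i ω' n ∂μ)| ∂μ := by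
        refine integral_mono_of_nonneg (Eventually.of_forall fun ω => ?_) (hint.const_mul _)
          (Eventually.of_forall hpt)
        exact Real.iSup_nonneg fun β => abs_nonneg _
    _ ≤ (m:ℝ)⁻¹ * ((R * (1 + 4 * C) + (1 + 4 * M ^ 2) / 2) * Real.sqrt m) := by
        rw [integral_const_mul]
        exact mul_le_mul_of_nonneg_left hbd (by positivity)
    _ = _ := by
        rw [Real.rpow_neg hm'.le, ← Real.sqrt_eq_rpow]
        have ha : 0 < Real.sqrt m := Real.sqrt_pos.2 hm'
        have hsq : Real.sqrt m * Real.sqrt m = m := Real.mul_self_sqrt hm'.le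
        have : (m:ℝ)⁻¹ * Real.sqrt m = (Real.sqrt m)⁻¹ := by
          nth_rewrite 1 [← hsq]
          field_simp
        rw [← this]; ring
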